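/- Let φ : ℝ → (0,∞) be a bounded Borel function with ∫_ℝ φ(u)du = 1, set Φ(s) = ∫_{−∞}^s φ(u)du, and define M_t^φ := (S_t − X_t)·φ(S_t) + 1 − Φ(S_t). Then for every x ∈ ℝ, every u ≥ 0, and every Γ ∈ F_u, lim_{t→∞} E_x[ 1_Γ · φ(S_t) ] / E_x[ φ(S_t) ] = E_x[ 1_Γ · M_u^φ ] / (1 − Φ(x)). -/

import Mathlib

open MeasureTheory ProbabilityTheory Filter
open scoped NNReal ENNReal Topology

noncomputable section

/-- The natural filtration `F_t = σ(X_s : s ≤ t)` of a real-valued process indexed by `ℝ≥0`. -/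
def natFiltration {Ω : Type*} [m : MeasurableSpace Ω] (X : ℝ≥0 → Ω → ℝ) :
    MeasureTheory.Filtration ℝ≥0 m where
  seq t := (⨆ s ∈ Set.Iic t, MeasurableSpace.comap (X s) Real.measurableSpace) ⊓ m
  mono' := fun s t hst =>
    inf_le_inf_right m (biSup_mono fun u (hu : u ∈ Set.Iic s) => le_trans hu hst)
  le' := fun _ => inf_le_right

/-- The running supremum `S_t = sup_{0 ≤ u ≤ t} X_u` of a process indexed by `ℝ≥0`. -/
def runSup {Ω : Type*} (X : ℝ≥0 → Ω → ℝ) (t : ℝ≥0) (ω : Ω) : ℝ :=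
  sSup ((fun u => X u ω) '' Set.Iic t)

/-- A real-valued process `X` indexed by `ℝ≥0` is a standard one-dimensional Brownian
motion started at `x` under `P`. -/
structure IsBrownianMotion {Ω : Type*} [m : MeasurableSpace Ω] (P : Measure Ω)
    (X : ℝ≥0 → Ω → ℝ) (x : ℝ) : Prop where
  stronglyMeasurable : ∀ t, StronglyMeasurable (X t)
  init : ∀ᵐ ω ∂P, X 0 ω = x
  cont : ∀ᵐ ω ∂P, Continuous fun t => X t ω
  gauss_incr : ∀ s t : ℝ≥0, s ≤ t →
    P.map (fun ω => X t ω - X s ω) = gaussianReal 0 (t - s)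
  indep_incr : ∀ s t : ℝ≥0, s ≤ t →
    Indep (MeasurableSpace.comap (fun ω => X t ω - X s ω) Real.measurableSpace)
      (natFiltration X s) P

lemma measurable_natFiltration {Ω : Type*} [MeasurableSpace Ω] {X : ℝ≥0 → Ω → ℝ}
    (hX : ∀ t, Measurable (X t)) {s t : ℝ≥0} (hst : s ≤ t) :
    Measurable[natFiltration X t] (X s) := by
  rw [measurable_iff_comap_le]
  refine le_inf ?_ (hX s).comap_le
  exact le_iSup₂_of_le (f := fun s (_ : s ∈ Set.Iic t) =>
    MeasurableSpace.comap (X s) Real.measurableSpace) s hst le_rfl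

/-- The supremum of a process over a countable dense subset of `[0, t]`. -/
def denseSup {Ω : Type*} (X : ℝ≥0 → Ω → ℝ) (t : ℝ≥0) (ω : Ω) : ℝ :=
  ⨆ n : ℕ, X (min (TopologicalSpace.denseSeq ℝ≥0 n) t) ω

lemma measurable_denseSup {Ω : Type*} [MeasurableSpace Ω] {X : ℝ≥0 → Ω → ℝ}
    (hX : ∀ t, Measurable (X t)) (t : ℝ≥0) : Measurable[natFiltration X t] (denseSup X t) :=
  Measurable.iSup (mδ := natFiltration X t)
    fun _ => measurable_natFiltration hX (min_le_right _ _)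

lemma isLUB_runSup {Ω : Type*} {X : ℝ≥0 → Ω → ℝ} {ω : Ω} (h : Continuous fun t => X t ω)
    (t : ℝ≥0) : IsLUB ((fun u => X u ω) '' Set.Iic t) (runSup X t ω) := by
  refine isLUB_csSup ⟨_, Set.mem_image_of_mem _ (Set.mem_Iic.2 le_rfl)⟩ ?_
  rw [← Set.Icc_bot]
  exact (isCompact_Icc.image h).bddAbove

lemma denseSup_eq_runSup {Ω : Type*} {X : ℝ≥0 → Ω → ℝ} {ω : Ω}
    (h : Continuous fun t => X t ω) (t : ℝ≥0) : denseSup X t ω = runSup X t ω := by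
  have hlub := isLUB_runSup h t
  have hle (n : ℕ) : X (min (TopologicalSpace.denseSeq ℝ≥0 n) t) ω ≤ runSup X t ω :=
    hlub.1 ⟨_, Set.mem_Iic.2 (min_le_right _ _), rfl⟩
  refine le_antisymm (ciSup_le hle) (hlub.2 ?_)
  rintro _ ⟨s, hs, rfl⟩
  have hcl : IsClosed {v : ℝ≥0 | X (min v t) ω ≤ denseSup X t ω} :=
    isClosed_le (h.comp (continuous_id.min continuous_const)) continuous_const
  have hsub : Set.range (TopologicalSpace.denseSeq ℝ≥0)
      ⊆ {v : ℝ≥0 | X (min v t) ω ≤ denseSup X t ω} := by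
    rintro _ ⟨n, rfl⟩
    exact le_ciSup (f := fun n : ℕ => X (min (TopologicalSpace.denseSeq ℝ≥0 n) t) ω)
      ⟨_, Set.forall_mem_range.2 hle⟩ n
  have hs' := hcl.closure_subset_iff.2 hsub (TopologicalSpace.denseRange_denseSeq ℝ≥0 s)
  simpa [min_eq_left (Set.mem_Iic.1 hs)] using hs'

lemma runSup_zero {Ω : Type*} (X : ℝ≥0 → Ω → ℝ) (ω : Ω) : runSup X 0 ω = X 0 ω := by
  have : Set.Iic (0 : ℝ≥0) = {0} := by ext v; simp
  simp [runSup, this]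

lemma runSup_add {Ω : Type*} {X : ℝ≥0 → Ω → ℝ} {ω : Ω} (h : Continuous fun t => X t ω)
    (u r : ℝ≥0) :
    runSup X (u + r) ω
      = max (runSup X u ω) (X u ω + runSup (fun v ω => X (u + v) ω - X u ω) r ω) := by
  have hY : Continuous fun v => X (u + v) ω - X u ω :=
    (h.comp (continuous_const.add continuous_id)).sub continuous_const
  have hS := isLUB_runSup h u
  have hS' := isLUB_runSup (X := fun v ω => X (u + v) ω - X u ω) hY r
  refine (isLUB_runSup h (u + r)).unique ⟨?_, fun b hb => max_le ?_ ?_⟩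
  · rintro _ ⟨v, hv, rfl⟩
    rcases le_total v u with hvu | huv
    · exact le_max_of_le_left (hS.1 ⟨v, hvu, rfl⟩)
    · obtain ⟨w, rfl⟩ := exists_add_of_le huv
      refine le_max_of_le_right ?_
      have := hS'.1 ⟨w, le_of_add_le_add_left (Set.mem_Iic.1 hv), rfl⟩
      dsimp only at this ⊢
      linarith
  · refine hS.2 ?_
    rintro _ ⟨v, hv, rfl⟩
    exact hb ⟨v, le_add_right (Set.mem_Iic.1 hv), rfl⟩
  · suffices runSup (fun v ω => X (u + v) ω - X u ω) r ω ≤ b - X u ω by linarith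
    refine hS'.2 ?_
    rintro _ ⟨v, hv, rfl⟩
    have := hb ⟨u + v, by simpa using hv, rfl⟩
    dsimp only at this ⊢
    linarith

lemma gaussianReal_map_abs_Ici (v : ℝ≥0) {a : ℝ} (ha : 0 < a) :
    (gaussianReal 0 v).map (fun y => |y|) (Set.Ici a) = 2 * gaussianReal 0 v (Set.Ici a) := by
  rw [Measure.map_apply (by fun_prop) measurableSet_Ici]
  have hpre : (fun y : ℝ => |y|) ⁻¹' Set.Ici a = Set.Ici a ∪ (fun y => -y) ⁻¹' Set.Ici a := by
    ext y; simp [le_abs, le_neg]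
  rw [hpre, measure_union _ (measurable_neg measurableSet_Ici),
    ← Measure.map_apply measurable_neg measurableSet_Ici, gaussianReal_map_neg, neg_zero, two_mul]
  rw [Set.disjoint_left]
  intro y hy hy'
  simp only [Set.mem_Ici, Set.mem_preimage] at hy hy'
  linarith

lemma gaussianReal_Iio_zero (v : ℝ≥0) :
    gaussianReal 0 v (Set.Iio 0) = gaussianReal 0 v (Set.Ioi 0) := by
  conv_lhs => rw [← neg_zero, ← gaussianReal_map_neg, Measure.map_apply measurable_neg
    measurableSet_Iio]
  congr 1
  ext y; simp

/-- Two probability measures on `[0, ∞)` agree as soon as their upper tails are intertwined. -/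
lemma eq_of_forall_Ici_le {μ ν : Measure ℝ} [IsProbabilityMeasure μ] [IsProbabilityMeasure ν]
    (hμ : μ (Set.Ici 0) = 1) (hν : ν (Set.Ici 0) = 1)
    (h₁ : ∀ a b, 0 < b → b < a → μ (Set.Ici a) ≤ ν (Set.Ici b))
    (h₂ : ∀ a b, 0 < b → b < a → ν (Set.Ici a) ≤ μ (Set.Ici b)) : μ = ν := by
  have key : ∀ {μ ν : Measure ℝ} [IsProbabilityMeasure μ] [IsProbabilityMeasure ν],
      ν (Set.Ici 0) = 1 → (∀ a b, 0 < b → b < a → μ (Set.Ici a) ≤ ν (Set.Ici b)) →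
      ∀ a, μ (Set.Ici a) ≤ ν (Set.Ici a) := by
    intro μ ν _ _ hν h a
    have hb (b : ℝ) (hb : b < a) : μ (Set.Ici a) ≤ ν (Set.Ici b) := by
      rcases lt_or_ge 0 b with h0 | h0
      · exact h a b h0 hb
      · exact prob_le_one.trans (hν.symm.le.trans (measure_mono (Set.Ici_subset_Ici.2 h0)))
    obtain ⟨w, hw, hwa, hwt⟩ := exists_seq_strictMono_tendsto a
    have hInter : ⋂ n, Set.Ici (w n) = Set.Ici a := by
      ext y
      simp only [Set.mem_iInter, Set.mem_Ici]
      exact ⟨fun hy => le_of_tendsto' hwt hy, fun hy n => (hwa n).le.trans hy⟩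
    have ht := tendsto_measure_iInter_atTop (μ := ν) (s := fun n => Set.Ici (w n))
      (fun n => measurableSet_Ici.nullMeasurableSet)
      (fun i j hij => Set.Ici_subset_Ici.2 (hw.monotone hij)) ⟨0, measure_ne_top _ _⟩
    rw [hInter] at ht
    exact ge_of_tendsto' ht fun n => hb _ (hwa n)
  exact Measure.ext_of_Ici μ ν fun a => le_antisymm (key hν h₁ a) (key hμ h₂ a)

namespace IsBrownianMotion

variable {Ω : Type*} [MeasurableSpace Ω] {P : Measure Ω} {X : ℝ≥0 → Ω → ℝ} {x : ℝ}

lemma measurable (hX : IsBrownianMotion P X x) (t : ℝ≥0) : Measurable (X t) :=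
  (hX.stronglyMeasurable t).measurable

lemma measure_inter_incr (hX : IsBrownianMotion P X x) {s t : ℝ≥0} (hst : s ≤ t) {A : Set Ω}
    (hA : MeasurableSet[natFiltration X s] A) {B : Set ℝ} (hB : MeasurableSet B) :
    P (A ∩ {ω | X t ω - X s ω ∈ B}) = P A * gaussianReal 0 (t - s) B := by
  have h := (Indep_iff _ _ _).1 (hX.indep_incr s t hst) _ A ⟨B, hB, rfl⟩ hA
  rw [← Measure.map_apply (by exact (hX.measurable t).sub (hX.measurable s)) hB,
    hX.gauss_incr s t hst] at h
  rw [Set.inter_comm, mul_comm, ← h]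
  rfl

/-- Increments of a Brownian motion are symmetric given the past. -/
lemma measure_inter_incr_neg (hX : IsBrownianMotion P X x) {s t : ℝ≥0} (hst : s ≤ t)
    {A : Set Ω} (hA : MeasurableSet[natFiltration X s] A) :
    P (A ∩ {ω | X t ω - X s ω < 0}) = P (A ∩ {ω | 0 < X t ω - X s ω}) := by
  have h₁ := hX.measure_inter_incr hst hA (measurableSet_Iio (a := (0 : ℝ)))
  have h₂ := hX.measure_inter_incr hst hA (measurableSet_Ioi (a := (0 : ℝ)))
  rw [gaussianReal_Iio_zero, ← h₂] at h₁
  exact h₁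

/-- The increments after time `u`, conditionally on an event of the past of `u`, form a Brownian
motion. -/
lemma shift_cond [IsProbabilityMeasure P] (hX : IsBrownianMotion P X x) (u : ℝ≥0) {Γ : Set Ω}
    (hΓ : MeasurableSet[natFiltration X u] Γ) (h0 : P Γ ≠ 0) :
    IsBrownianMotion (cond P Γ) (fun v ω => X (u + v) ω - X u ω) 0 := by
  have hΓm : MeasurableSet Γ := (natFiltration X).le u _ hΓ
  have hmY (v : ℝ≥0) : Measurable fun ω => X (u + v) ω - X u ω :=
    (hX.measurable _).sub (hX.measurable _)
  have hac : cond P Γ ≪ P := cond_absolutelyContinuous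
  have hF (s : ℝ≥0) : natFiltration (fun v ω => X (u + v) ω - X u ω) s
      ≤ natFiltration X (u + s) := by
    refine inf_le_left.trans (iSup₂_le fun v hv => ?_)
    rw [← measurable_iff_comap_le]
    exact (measurable_natFiltration hX.measurable (by simpa using hv)).sub
      (measurable_natFiltration hX.measurable le_self_add)
  have key (s t : ℝ≥0) (hst : s ≤ t) (A : Set Ω) (hA : MeasurableSet[natFiltration X (u + s)] A)
      (B : Set ℝ) (hB : MeasurableSet B) :
      cond P Γ ({ω | X (u + t) ω - X u ω - (X (u + s) ω - X u ω) ∈ B} ∩ A)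
        = gaussianReal 0 (t - s) B * cond P Γ A := by
    have hΓs : MeasurableSet[natFiltration X (u + s)] Γ :=
      (natFiltration X).mono le_self_add _ hΓ
    have := hX.measure_inter_incr (add_le_add_right hst u) (hΓs.inter hA) hB
    rw [add_tsub_add_eq_tsub_left] at this
    simp only [sub_sub_sub_cancel_right]
    rw [cond_apply hΓm, cond_apply hΓm, Set.inter_comm _ A, ← Set.inter_assoc, this]
    ring
  have : IsProbabilityMeasure (cond P Γ) := cond_isProbabilityMeasure h0
  have hlaw (s t : ℝ≥0) (hst : s ≤ t) (B : Set ℝ) (hB : MeasurableSet B) :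
      cond P Γ {ω | X (u + t) ω - X u ω - (X (u + s) ω - X u ω) ∈ B}
        = gaussianReal 0 (t - s) B := by
    simpa using key s t hst Set.univ MeasurableSet.univ B hB
  refine ⟨fun t => (hmY t).stronglyMeasurable, ae_of_all _ fun ω => by simp, ?_, ?_, ?_⟩
  · filter_upwards [hac.ae_le hX.cont] with ω hω
    exact (hω.comp (continuous_const.add continuous_id)).sub continuous_const
  · intro s t hst
    ext B hB
    rw [Measure.map_apply (by exact (hmY t).sub (hmY s)) hB]
    exact hlaw s t hst B hB
  · intro s t hst
    rw [Indep_iff]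
    rintro _ A ⟨B, hB, rfl⟩ hA
    have h := key s t hst A (hF s _ hA) B hB
    rw [← hlaw s t hst B hB] at h
    exact h

end IsBrownianMotion

/-- The event that `k` is the first index at which the process sampled along `τ` is at least
`a`. -/
def firstPassage {Ω : Type*} (X : ℝ≥0 → Ω → ℝ) (τ : ℕ → ℝ≥0) (a : ℝ) (k : ℕ) : Set Ω :=
  {ω | a ≤ X (τ k) ω ∧ ∀ j < k, X (τ j) ω < a}

lemma pairwise_disjoint_firstPassage {Ω : Type*} (X : ℝ≥0 → Ω → ℝ) (τ : ℕ → ℝ≥0) (a : ℝ) :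
    Pairwise (Function.onFun Disjoint (firstPassage X τ a)) := by
  refine (pairwise_disjoint_on _).2 fun i j hij => Set.disjoint_left.2 fun ω hi hj => ?_
  exact (hj.2 i hij).not_ge hi.1

lemma exists_mem_firstPassage {Ω : Type*} {X : ℝ≥0 → Ω → ℝ} {τ : ℕ → ℝ≥0} {a : ℝ} {n : ℕ} {ω : Ω}
    (h : ∃ k ≤ n, a ≤ X (τ k) ω) : ∃ k ≤ n, ω ∈ firstPassage X τ a k := by
  classical
  obtain ⟨k, hk, hak⟩ := h
  have hex : ∃ k, a ≤ X (τ k) ω := ⟨k, hak⟩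
  exact ⟨Nat.find hex, (Nat.find_min' hex hak).trans hk, Nat.find_spec hex,
    fun j hj => not_le.1 (Nat.find_min hex hj)⟩

namespace IsBrownianMotion

variable {Ω : Type*} [MeasurableSpace Ω] {P : Measure Ω} {X : ℝ≥0 → Ω → ℝ} {x : ℝ}

lemma measurableSet_firstPassage (hX : IsBrownianMotion P X x) {τ : ℕ → ℝ≥0} (hτ : Monotone τ)
    (a : ℝ) (k : ℕ) : MeasurableSet[natFiltration X (τ k)] (firstPassage X τ a k) := by
  have hm (j : ℕ) (hj : j ≤ k) : Measurable[natFiltration X (τ k)] (X (τ j)) :=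
    measurable_natFiltration hX.measurable (hτ hj)
  have : firstPassage X τ a k
      = X (τ k) ⁻¹' Set.Ici a ∩ ⋂ j, ⋂ (_ : j < k), X (τ j) ⁻¹' Set.Iio a := by
    ext ω; simp [firstPassage]
  rw [this]
  exact (hm k le_rfl measurableSet_Ici).inter
    (MeasurableSet.iInter fun j => MeasurableSet.iInter fun hj => hm j hj.le measurableSet_Iio)

/-- Reflection inequality for a sampled Brownian motion. -/
lemma measure_exists_le_le (hX : IsBrownianMotion P X x) {τ : ℕ → ℝ≥0} (hτ : Monotone τ)
    (a : ℝ) (n : ℕ) :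
    P {ω | ∃ k ≤ n, a ≤ X (τ k) ω} ≤ 2 * P {ω | a ≤ X (τ n) ω} := by
  have hF (k : ℕ) : MeasurableSet (firstPassage X τ a k) :=
    (natFiltration X).le _ _ (hX.measurableSet_firstPassage hτ a k)
  have hE : MeasurableSet {ω | a ≤ X (τ n) ω} := measurableSet_le measurable_const (hX.measurable _)
  have hterm (k : ℕ) (hk : k ≤ n) :
      P (firstPassage X τ a k) ≤ 2 * P (firstPassage X τ a k ∩ {ω | a ≤ X (τ n) ω}) := by
    rw [← measure_inter_add_sdiff (firstPassage X τ a k) hE, two_mul]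
    gcongr 1
    calc P (firstPassage X τ a k \ {ω | a ≤ X (τ n) ω})
        ≤ P (firstPassage X τ a k ∩ {ω | X (τ n) ω - X (τ k) ω < 0}) := by
          refine measure_mono fun ω hω => ⟨hω.1, ?_⟩
          have h₁ := hω.1.1
          have h₂ : X (τ n) ω < a := not_le.1 hω.2
          exact sub_neg.2 (h₂.trans_le h₁)
      _ = P (firstPassage X τ a k ∩ {ω | 0 < X (τ n) ω - X (τ k) ω}) :=
          hX.measure_inter_incr_neg (hτ hk) (hX.measurableSet_firstPassage hτ a k)
      _ ≤ _ := by
          refine measure_mono fun ω hω => ⟨hω.1, ?_⟩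
          have h₁ := hω.1.1
          exact h₁.trans (sub_pos.1 hω.2).le
  calc P {ω | ∃ k ≤ n, a ≤ X (τ k) ω}
      ≤ P (⋃ k ∈ Finset.range (n + 1), firstPassage X τ a k) := by
        refine measure_mono fun ω hω => ?_
        obtain ⟨k, hk, h⟩ := exists_mem_firstPassage hω
        simp only [Set.mem_iUnion, Finset.mem_range]
        exact ⟨k, by omega, h⟩
    _ ≤ ∑ k ∈ Finset.range (n + 1), P (firstPassage X τ a k) := measure_biUnion_finset_le _ _
    _ ≤ ∑ k ∈ Finset.range (n + 1), 2 * P (firstPassage X τ a k ∩ {ω | a ≤ X (τ n) ω}) :=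
        Finset.sum_le_sum fun k hk => hterm k (by simpa [Nat.lt_succ_iff] using hk)
    _ = 2 * P (⋃ k ∈ Finset.range (n + 1), firstPassage X τ a k ∩ {ω | a ≤ X (τ n) ω}) := by
        rw [← Finset.mul_sum, measure_biUnion_finset]
        · exact fun i _ j _ hij => (pairwise_disjoint_firstPassage X τ a hij).mono
            Set.inter_subset_left Set.inter_subset_left
        · exact fun k _ => (hF k).inter hE
    _ ≤ 2 * P {ω | a ≤ X (τ n) ω} := by
        gcongr
        exact Set.iUnion₂_subset fun _ _ => Set.inter_subset_right

/-- Converse reflection inequality for a sampled Brownian motion, up to the overshoot. -/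
lemma two_mul_measure_le [IsProbabilityMeasure P] (hX : IsBrownianMotion P X x) {τ : ℕ → ℝ≥0}
    (hτ : Monotone τ) {a b : ℝ} (hab : a < b) (n : ℕ) :
    2 * P {ω | b ≤ X (τ n) ω} ≤ P {ω | ∃ k ≤ n, a ≤ X (τ k) ω}
      + 2 * P {ω | (∃ k < n, b - a ≤ X (τ (k + 1)) ω - X (τ k) ω) ∨ a ≤ X (τ 0) ω} := by
  set F : ℕ → Set Ω := fun k => firstPassage X τ a k ∩ {ω | X (τ k) ω < b} with hFdef
  have hFt (k : ℕ) : MeasurableSet[natFiltration X (τ k)] (F k) :=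
    (hX.measurableSet_firstPassage hτ a k).inter
      (measurable_natFiltration hX.measurable le_rfl measurableSet_Iio)
  have hF (k : ℕ) : MeasurableSet (F k) := (natFiltration X).le _ _ (hFt k)
  have hE : MeasurableSet {ω | b ≤ X (τ n) ω} := measurableSet_le measurable_const (hX.measurable _)
  have hdisj : Pairwise (Function.onFun Disjoint F) := fun i j hij =>
    (pairwise_disjoint_firstPassage X τ a hij).mono Set.inter_subset_left Set.inter_subset_left
  have hterm (k : ℕ) (hk : k ≤ n) : 2 * P (F k ∩ {ω | b ≤ X (τ n) ω}) ≤ P (F k) := by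
    rw [← measure_inter_add_sdiff (F k) hE, two_mul]
    gcongr 1
    calc P (F k ∩ {ω | b ≤ X (τ n) ω})
        ≤ P (F k ∩ {ω | 0 < X (τ n) ω - X (τ k) ω}) := by
          refine measure_mono fun ω hω => ⟨hω.1, ?_⟩
          have h₁ : X (τ k) ω < b := hω.1.2
          exact sub_pos.2 (h₁.trans_le hω.2)
      _ = P (F k ∩ {ω | X (τ n) ω - X (τ k) ω < 0}) :=
          (hX.measure_inter_incr_neg (hτ hk) (hFt k)).symm
      _ ≤ _ := by
          refine measure_mono fun ω hω => ⟨hω.1, ?_⟩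
          have h₁ : X (τ k) ω < b := hω.1.2
          exact not_le.2 ((sub_neg.1 hω.2).trans h₁)
  have hcover : {ω | b ≤ X (τ n) ω} ⊆
      (⋃ k ∈ Finset.range (n + 1), F k ∩ {ω | b ≤ X (τ n) ω}) ∪
        {ω | (∃ k < n, b - a ≤ X (τ (k + 1)) ω - X (τ k) ω) ∨ a ≤ X (τ 0) ω} := by
    intro ω hω
    obtain ⟨k, hk, h⟩ := exists_mem_firstPassage (X := X) (τ := τ) (a := a)
      ⟨n, le_rfl, hab.le.trans hω⟩
    rcases lt_or_ge (X (τ k) ω) b with hb | hb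
    · refine Or.inl ?_
      simp only [Set.mem_iUnion, Finset.mem_range]
      exact ⟨k, by omega, ⟨h, hb⟩, hω⟩
    · refine Or.inr ?_
      rcases k with _ | k
      · exact Or.inr h.1
      · refine Or.inl ⟨k, hk, ?_⟩
        have := h.2 k k.lt_succ_self
        linarith
  calc 2 * P {ω | b ≤ X (τ n) ω}
      ≤ 2 * (P (⋃ k ∈ Finset.range (n + 1), F k ∩ {ω | b ≤ X (τ n) ω})
        + P {ω | (∃ k < n, b - a ≤ X (τ (k + 1)) ω - X (τ k) ω) ∨ a ≤ X (τ 0) ω}) := by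
        gcongr
        exact (measure_mono hcover).trans (measure_union_le _ _)
    _ ≤ _ := by
        rw [mul_add]
        gcongr 1
        calc 2 * P (⋃ k ∈ Finset.range (n + 1), F k ∩ {ω | b ≤ X (τ n) ω})
            ≤ 2 * ∑ k ∈ Finset.range (n + 1), P (F k ∩ {ω | b ≤ X (τ n) ω}) := by
              gcongr
              exact measure_biUnion_finset_le _ _
          _ ≤ ∑ k ∈ Finset.range (n + 1), P (F k) := by
              rw [Finset.mul_sum]
              exact Finset.sum_le_sum fun k hk => hterm k (by simpa [Nat.lt_succ_iff] using hk)
          _ = P (⋃ k ∈ Finset.range (n + 1), F k) :=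
              (measure_biUnion_finset (fun i _ j _ hij => hdisj hij) fun k _ => hF k).symm
          _ ≤ _ := by
              refine measure_mono fun ω hω => ?_
              simp only [Set.mem_iUnion, Finset.mem_range] at hω
              obtain ⟨k, hk, h⟩ := hω
              exact ⟨k, by omega, h.1.1⟩

end IsBrownianMotion

/-- The `k`-th point of the subdivision of `[0, T]` into `n + 1` intervals of equal length. -/
def gridTime (T : ℝ≥0) (n k : ℕ) : ℝ≥0 := k / (n + 1) * T

lemma monotone_gridTime (T : ℝ≥0) (n : ℕ) : Monotone (gridTime T n) := fun i j hij => by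
  unfold gridTime; gcongr

@[simp] lemma gridTime_zero (T : ℝ≥0) (n : ℕ) : gridTime T n 0 = 0 := by simp [gridTime]

@[simp] lemma gridTime_last (T : ℝ≥0) (n : ℕ) : gridTime T n (n + 1) = T := by
  simp [gridTime]

lemma gridTime_le {T : ℝ≥0} {n k : ℕ} (hk : k ≤ n + 1) : gridTime T n k ≤ T :=
  (monotone_gridTime T n hk).trans (gridTime_last T n).le

lemma gridTime_succ (T : ℝ≥0) (n k : ℕ) :
    gridTime T n (k + 1) = gridTime T n k + T / (n + 1) := by
  simp only [gridTime, Nat.cast_succ]; ring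

lemma tendsto_gridTime_mesh (T : ℝ≥0) : Tendsto (fun n : ℕ => T / (n + 1 : ℝ≥0)) atTop (𝓝 0) := by
  rw [← NNReal.tendsto_coe]
  have := (tendsto_one_div_add_atTop_nhds_zero_nat (𝕜 := ℝ)).const_mul (T : ℝ)
  simpa [div_eq_mul_inv] using this

lemma exists_gridTime_le (T : ℝ≥0) (n : ℕ) {v : ℝ≥0} (hv : v ≤ T) :
    ∃ k ≤ n + 1, gridTime T n k ≤ v ∧ v ≤ gridTime T n k + T / (n + 1) := by
  classical
  have hex : ∃ k, v ≤ gridTime T n k := ⟨n + 1, by simpa using hv⟩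
  have hspec := Nat.find_spec hex
  have hle : Nat.find hex ≤ n + 1 := Nat.find_min' hex (by simpa using hv)
  rcases hk : Nat.find hex with _ | k
  · rw [hk, gridTime_zero] at hspec
    refine ⟨0, by omega, by simp, by simpa using hspec.trans zero_le⟩
  · rw [hk] at hle hspec
    refine ⟨k, by omega, ?_, gridTime_succ T n k ▸ hspec⟩
    exact (not_le.1 (Nat.find_min hex (m := k) (by omega))).le

/-- A continuous path on `[0, T]` oscillates little along fine subdivisions. -/
lemma eventually_gridTime_dist_lt {f : ℝ≥0 → ℝ} (hf : Continuous f) (T : ℝ≥0) {ε : ℝ}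
    (hε : 0 < ε) : ∀ᶠ n : ℕ in atTop, ∀ s ≤ T, ∀ t ≤ T, s ≤ t → t ≤ s + T / (n + 1) →
      |f t - f s| < ε := by
  have hK : IsCompact (Set.Iic T) := by rw [← Set.Icc_bot]; exact isCompact_Icc
  obtain ⟨δ, hδ, h⟩ := Metric.uniformContinuousOn_iff.1
    (hK.uniformContinuousOn_of_continuous hf.continuousOn) ε hε
  have hδ' : (0 : ℝ≥0) < ⟨δ, hδ.le⟩ := hδ
  filter_upwards [(tendsto_gridTime_mesh T).eventually_lt_const hδ'] with n hn s hs t ht hst hts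
  refine h t ht s hs ?_
  rw [NNReal.dist_eq, abs_of_nonneg (sub_nonneg.2 (NNReal.coe_le_coe.2 hst))]
  have h₁ : (t : ℝ) ≤ s + (T / (n + 1) : ℝ≥0) := by exact_mod_cast hts
  have h₂ : ((T / (n + 1) : ℝ≥0) : ℝ) < δ := hn
  linarith

lemma tendsto_measure_zero_of_ae_eventually_notMem {Ω : Type*} [MeasurableSpace Ω]
    {P : Measure Ω} [IsFiniteMeasure P] {C : ℕ → Set Ω} (hC : ∀ n, MeasurableSet (C n))
    (h : ∀ᵐ ω ∂P, ∀ᶠ n in atTop, ω ∉ C n) : Tendsto (fun n => P (C n)) atTop (𝓝 0) := by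
  rw [← measure_empty (μ := P)]
  refine tendsto_measure_of_ae_tendsto_indicator_of_isFiniteMeasure atTop MeasurableSet.empty hC ?_
  filter_upwards [h] with ω hω
  filter_upwards [hω] with n hn
  simpa using hn

namespace IsBrownianMotion

variable {Ω : Type*} [MeasurableSpace Ω] {P : Measure Ω} {X : ℝ≥0 → Ω → ℝ} {x : ℝ}

lemma denseSup_ae_eq (hX : IsBrownianMotion P X x) (t : ℝ≥0) :
    denseSup X t =ᵐ[P] runSup X t := by
  filter_upwards [hX.cont] with ω hω using denseSup_eq_runSup hω t

lemma aemeasurable_runSup (hX : IsBrownianMotion P X x) (t : ℝ≥0) : AEMeasurable (runSup X t) P :=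
  ⟨denseSup X t, (measurable_denseSup hX.measurable t).mono ((natFiltration X).le t) le_rfl,
    (hX.denseSup_ae_eq t).symm⟩

lemma measure_le_eq_gaussianReal (hX : IsBrownianMotion P X 0) (T : ℝ≥0) (b : ℝ) :
    P {ω | b ≤ X T ω} = gaussianReal 0 T (Set.Ici b) := by
  have h := hX.gauss_incr 0 T zero_le
  rw [tsub_zero] at h
  rw [← h, Measure.map_apply (by exact (hX.measurable T).sub (hX.measurable 0)) measurableSet_Ici]
  refine measure_congr ?_
  filter_upwards [hX.init] with ω hω
  refine propext ?_
  change b ≤ X T ω ↔ b ≤ X T ω - X 0 ω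
  rw [hω, sub_zero]

/-- Reflection principle: `S_T` has the law of `|N|` with `N` a centred Gaussian variable of
variance `T`. -/
lemma map_runSup [IsProbabilityMeasure P] (hX : IsBrownianMotion P X 0) (T : ℝ≥0) :
    P.map (runSup X T) = (gaussianReal 0 T).map (fun y => |y|) := by
  have hSm : Measurable (denseSup X T) :=
    (measurable_denseSup hX.measurable T).mono ((natFiltration X).le T) le_rfl
  rw [← Measure.map_congr (hX.denseSup_ae_eq T)]
  have := Measure.isProbabilityMeasure_map (μ := P) hSm.aemeasurable
  have := Measure.isProbabilityMeasure_map (μ := gaussianReal 0 T) (f := fun y => |y|)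
    (by fun_prop)
  have hSpos : ∀ᵐ ω ∂P, 0 ≤ denseSup X T ω := by
    filter_upwards [hX.cont, hX.init] with ω hc h0
    rw [denseSup_eq_runSup hc, ← h0]
    exact (isLUB_runSup hc T).1 ⟨0, Set.mem_Iic.2 zero_le, rfl⟩
  refine eq_of_forall_Ici_le ?_ ?_ ?_ ?_
  · rw [Measure.map_apply hSm measurableSet_Ici]
    exact (mem_ae_iff_prob_eq_one (hSm measurableSet_Ici)).1 hSpos
  · rw [Measure.map_apply (by fun_prop) measurableSet_Ici]
    convert measure_univ (μ := gaussianReal 0 T)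
    ext y; simp
  · intro a b hb hba
    rw [Measure.map_apply hSm measurableSet_Ici, gaussianReal_map_abs_Ici T hb,
      ← hX.measure_le_eq_gaussianReal]
    set C : ℕ → Set Ω := fun n =>
      {ω | a ≤ denseSup X T ω ∧ ∀ k ≤ n + 1, X (gridTime T n k) ω < b} with hCdef
    have hCm (n : ℕ) : MeasurableSet (C n) := by
      refine (measurableSet_le measurable_const hSm).inter ?_
      have : {ω | ∀ k ≤ n + 1, X (gridTime T n k) ω < b}
          = ⋂ k, ⋂ (_ : k ≤ n + 1), {ω | X (gridTime T n k) ω < b} := by ext ω; simp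
      change MeasurableSet {ω | ∀ k ≤ n + 1, X (gridTime T n k) ω < b}
      rw [this]
      exact MeasurableSet.iInter fun k => MeasurableSet.iInter fun _ =>
        measurableSet_lt (hX.measurable _) measurable_const
    have hlim : Tendsto (fun n => 2 * P {ω | b ≤ X T ω} + P (C n)) atTop
        (𝓝 (2 * P {ω | b ≤ X T ω} + 0)) := by
      refine tendsto_const_nhds.add (tendsto_measure_zero_of_ae_eventually_notMem hCm ?_)
      filter_upwards [hX.cont] with ω hc
      filter_upwards [eventually_gridTime_dist_lt hc T (half_pos (sub_pos.2 hba))] with n hn hmem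
      have hlt : (a + b) / 2 < runSup X T ω := by
        have := hmem.1
        rw [denseSup_eq_runSup hc] at this
        linarith
      obtain ⟨_, ⟨v, hv, rfl⟩, hvlt⟩ := (lt_isLUB_iff (isLUB_runSup hc T)).1 hlt
      obtain ⟨k, hk, hkv, hvk⟩ := exists_gridTime_le T n hv
      have h₁ := (abs_lt.1 (hn _ (gridTime_le hk) v hv hkv hvk)).2
      have h₂ := hmem.2 k hk
      dsimp only at hvlt
      linarith
    rw [add_zero] at hlim
    refine ge_of_tendsto' hlim fun n => ?_
    calc P (denseSup X T ⁻¹' Set.Ici a)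
        ≤ P ({ω | ∃ k ≤ n + 1, b ≤ X (gridTime T n k) ω} ∪ C n) := by
          refine measure_mono fun ω hω => ?_
          by_cases h : ∃ k ≤ n + 1, b ≤ X (gridTime T n k) ω
          · exact Or.inl h
          · push Not at h
            exact Or.inr ⟨hω, h⟩
      _ ≤ _ := measure_union_le _ _
      _ ≤ _ := by
          gcongr
          simpa using hX.measure_exists_le_le (monotone_gridTime T n) b (n + 1)
  · intro a b hb hba
    rw [Measure.map_apply hSm measurableSet_Ici, gaussianReal_map_abs_Ici T (hb.trans hba),
      ← hX.measure_le_eq_gaussianReal]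
    set D : ℕ → Set Ω := fun n => {ω | (∃ k < n + 1, a - b ≤ X (gridTime T n (k + 1)) ω
      - X (gridTime T n k) ω) ∨ b ≤ X (gridTime T n 0) ω} with hDdef
    have hDm (n : ℕ) : MeasurableSet (D n) := by
      refine MeasurableSet.union ?_ (measurableSet_le measurable_const (hX.measurable _))
      have : {ω | ∃ k < n + 1, a - b ≤ X (gridTime T n (k + 1)) ω - X (gridTime T n k) ω}
          = ⋃ k, ⋃ (_ : k < n + 1),
            {ω | a - b ≤ X (gridTime T n (k + 1)) ω - X (gridTime T n k) ω} := by ext ω; simp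
      change MeasurableSet
        {ω | ∃ k < n + 1, a - b ≤ X (gridTime T n (k + 1)) ω - X (gridTime T n k) ω}
      rw [this]
      exact MeasurableSet.iUnion fun k => MeasurableSet.iUnion fun _ =>
        (measurableSet_le measurable_const ((hX.measurable _).sub (hX.measurable _)))
    have hD0 : Tendsto (fun n => P (D n)) atTop (𝓝 0) := by
      refine tendsto_measure_zero_of_ae_eventually_notMem hDm ?_
      filter_upwards [hX.cont, hX.init] with ω hc h0
      filter_upwards [eventually_gridTime_dist_lt hc T (sub_pos.2 hba)] with n hn hmem
      rcases hmem with ⟨k, hk, h⟩ | h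
      · have := hn _ (gridTime_le hk.le) _ (gridTime_le (Nat.succ_le_of_lt hk))
          (monotone_gridTime T n k.le_succ) (gridTime_succ T n k).le
        exact absurd h (not_le.2 (abs_lt.1 this).2)
      · rw [gridTime_zero, h0] at h
        exact absurd hb (not_lt.2 h)
    have hlim : Tendsto (fun n => P (denseSup X T ⁻¹' Set.Ici b) + 2 * P (D n)) atTop
        (𝓝 (P (denseSup X T ⁻¹' Set.Ici b) + 2 * 0)) :=
      tendsto_const_nhds.add (ENNReal.Tendsto.const_mul hD0 (Or.inr (by simp)))
    rw [mul_zero, add_zero] at hlim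
    refine ge_of_tendsto' hlim fun n => ?_
    have h := hX.two_mul_measure_le (monotone_gridTime T n) hba (n + 1)
    rw [gridTime_last] at h
    refine h.trans ?_
    gcongr 1
    refine measure_mono_ae ?_
    filter_upwards [hX.cont] with ω hc
    rintro ⟨k, hk, h⟩
    change b ≤ denseSup X T ω
    rw [denseSup_eq_runSup hc]
    exact h.trans ((isLUB_runSup hc T).1 ⟨_, gridTime_le hk, rfl⟩)

end IsBrownianMotion

lemma IsBrownianMotion.integrable_sub {Ω : Type*} [MeasurableSpace Ω] {P : Measure Ω}
    {X : ℝ≥0 → Ω → ℝ} {x : ℝ} (hX : IsBrownianMotion P X x) (t : ℝ≥0) :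
    Integrable (fun ω => X t ω - X 0 ω) P := by
  have h := hX.gauss_incr 0 t zero_le
  have hm : AEMeasurable (fun ω => X t ω - X 0 ω) P :=
    ((hX.measurable t).sub (hX.measurable 0)).aemeasurable
  have hi : Integrable id (P.map fun ω => X t ω - X 0 ω) := by
    rw [h]
    exact (memLp_id_gaussianReal 1).integrable le_rfl
  exact (integrable_map_measure measurable_id.aestronglyMeasurable hm).1 hi

namespace IsBrownianMotion

variable {Ω : Type*} [MeasurableSpace Ω] {P : Measure Ω} [IsProbabilityMeasure P]
  {X : ℝ≥0 → Ω → ℝ} {x : ℝ}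

lemma shift (hX : IsBrownianMotion P X x) (u : ℝ≥0) :
    IsBrownianMotion P (fun v ω => X (u + v) ω - X u ω) 0 := by
  simpa using hX.shift_cond u MeasurableSet.univ (by simp)

/-- The maximum of the increments after time `u` is independent of the past of `u` and follows
the law given by the reflection principle. -/
lemma measure_inter_denseSup_shift (hX : IsBrownianMotion P X x) (u r : ℝ≥0) {Γ : Set Ω}
    (hΓ : MeasurableSet[natFiltration X u] Γ) {B : Set ℝ} (hB : MeasurableSet B) :
    P (Γ ∩ denseSup (fun v ω => X (u + v) ω - X u ω) r ⁻¹' B)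
      = P Γ * (gaussianReal 0 r).map (fun y => |y|) B := by
  rcases eq_or_ne (P Γ) 0 with h0 | h0
  · rw [h0, zero_mul]
    exact measure_mono_null Set.inter_subset_left h0
  have hY := hX.shift_cond u hΓ h0
  have : IsProbabilityMeasure (cond P Γ) := cond_isProbabilityMeasure h0
  have hm : Measurable (denseSup (fun v ω => X (u + v) ω - X u ω) r) :=
    (measurable_denseSup hY.measurable r).mono ((natFiltration _).le r) le_rfl
  rw [← hY.map_runSup r, ← Measure.map_congr (hY.denseSup_ae_eq r), Measure.map_apply hm hB,
    cond_apply ((natFiltration X).le u _ hΓ), ← mul_assoc,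
    ENNReal.mul_inv_cancel h0 (measure_ne_top _ _), one_mul]

lemma setIntegral_comp_runSup_add (hX : IsBrownianMotion P X x) (u r : ℝ≥0) {Γ : Set Ω}
    (hΓ : MeasurableSet[natFiltration X u] Γ) {φ : ℝ → ℝ} (hφ : Measurable φ) {C : ℝ}
    (hC : ∀ s, ‖φ s‖ ≤ C) :
    ∫ ω in Γ, φ (runSup X (u + r) ω) ∂P
      = ∫ ω in Γ, ∫ y, φ (max (denseSup X u ω) (X u ω + |y|)) ∂gaussianReal 0 r ∂P := by
  set Y : ℝ≥0 → Ω → ℝ := fun v ω => X (u + v) ω - X u ω with hYdef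
  have hY : IsBrownianMotion P Y 0 := hX.shift u
  set V : Ω → ℝ × ℝ := fun ω => (denseSup X u ω, X u ω) with hVdef
  set ν : Measure ℝ := (gaussianReal 0 r).map (fun y => |y|) with hνdef
  have hνp : IsProbabilityMeasure ν := Measure.isProbabilityMeasure_map (by fun_prop)
  have hVF : Measurable[natFiltration X u] V :=
    (measurable_denseSup hX.measurable u).prodMk (measurable_natFiltration hX.measurable le_rfl)
  have hV : Measurable V := hVF.mono ((natFiltration X).le u) le_rfl
  have hS : Measurable (denseSup Y r) :=
    (measurable_denseSup hY.measurable r).mono ((natFiltration Y).le r) le_rfl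
  have hlaw : ((P.restrict Γ).map V).prod ν = (P.restrict Γ).map fun ω => (V ω, denseSup Y r ω) := by
    refine Measure.prod_eq fun A B hA hB => ?_
    rw [Measure.map_apply (hV.prodMk hS) (hA.prod hB), Measure.map_apply hV hA,
      Measure.restrict_apply (hV hA), Set.mk_preimage_prod,
      Measure.restrict_apply ((hV hA).inter (hS hB)), Set.inter_right_comm]
    exact hX.measure_inter_denseSup_shift u r ((hVF hA).inter hΓ) hB
  set F : (ℝ × ℝ) × ℝ → ℝ := fun p => φ (max p.1.1 (p.1.2 + p.2)) with hFdef
  have hF : Measurable F := by fun_prop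
  calc ∫ ω in Γ, φ (runSup X (u + r) ω) ∂P
      = ∫ ω in Γ, F (V ω, denseSup Y r ω) ∂P := by
        refine integral_congr_ae (ae_restrict_of_ae ?_)
        filter_upwards [hX.cont, hY.denseSup_ae_eq r] with ω hc hd
        rw [runSup_add hc, ← denseSup_eq_runSup hc]
        simp only [hFdef, hVdef]
        rw [hd]
    _ = ∫ p, F p ∂((P.restrict Γ).map V).prod ν := by
        rw [hlaw, integral_map (hV.prodMk hS).aemeasurable hF.aestronglyMeasurable]
    _ = ∫ p, ∫ y, F (p, y) ∂ν ∂(P.restrict Γ).map V := by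
        refine integral_prod _ (Integrable.of_bound hF.aestronglyMeasurable C ?_)
        exact ae_of_all _ fun p => hC _
    _ = ∫ ω in Γ, ∫ y, F (V ω, y) ∂ν ∂P := by
        refine integral_map hV.aemeasurable ?_
        exact (hF.stronglyMeasurable.integral_prod_right').aestronglyMeasurable
    _ = _ := by
        refine integral_congr_ae (ae_of_all _ fun ω => ?_)
        exact integral_map (by fun_prop)
          (hF.comp (measurable_const.prodMk measurable_id)).aestronglyMeasurable

lemma integrable_eval_zero (hX : IsBrownianMotion P X x) : Integrable (X 0) P :=
  (integrable_const x).congr (hX.init.mono fun _ h => h.symm)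

lemma integrable_eval (hX : IsBrownianMotion P X x) (t : ℝ≥0) : Integrable (X t) P := by
  refine ((hX.integrable_sub t).add hX.integrable_eval_zero).congr (ae_of_all _ fun ω => ?_)
  simp

lemma integrable_runSup (hX : IsBrownianMotion P X x) (t : ℝ≥0) : Integrable (runSup X t) P := by
  have hY := hX.shift 0
  have hi : Integrable id ((gaussianReal 0 t).map fun y => |y|) := by
    rw [integrable_map_measure measurable_id.aestronglyMeasurable (by fun_prop)]
    exact ((memLp_id_gaussianReal 1).integrable le_rfl).abs
  rw [← hY.map_runSup t] at hi
  have hYi := (integrable_map_measure measurable_id.aestronglyMeasurable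
    (hY.aemeasurable_runSup t)).1 hi
  refine (hX.integrable_eval_zero.sup (hX.integrable_eval_zero.add hYi)).congr ?_
  filter_upwards [hX.cont] with ω hc
  have h := runSup_add hc 0 t
  rw [zero_add] at h
  rw [h]
  rw [runSup_zero]
  rfl

end IsBrownianMotion

lemma sqrt_mul_integral_gaussianReal {r : ℝ≥0} (hr : r ≠ 0) (h : ℝ → ℝ) :
    √(2 * Real.pi * r) * ∫ y, h y ∂gaussianReal 0 r
      = ∫ y, Real.exp (-y ^ 2 / (2 * r)) * h y := by
  have hpos : 0 < √(2 * Real.pi * r) := by positivity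
  rw [integral_gaussianReal_eq_integral_smul hr, ← integral_const_mul]
  congr with y
  simp only [gaussianPDFReal, sub_zero, smul_eq_mul]
  field_simp

lemma exp_neg_sq_div_le_one (r : ℝ≥0) (y : ℝ) : Real.exp (-y ^ 2 / (2 * r)) ≤ 1 :=
  Real.exp_le_one_iff.2 (div_nonpos_of_nonpos_of_nonneg (by nlinarith) (by positivity))

/-- Gaussian averages at large variance, suitably rescaled, converge to Lebesgue integrals. -/
lemma tendsto_sqrt_mul_integral_gaussianReal {h : ℝ → ℝ} (hh : Integrable h) :
    Tendsto (fun r : ℝ≥0 => √(2 * Real.pi * r) * ∫ y, h y ∂gaussianReal 0 r) atTop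
      (𝓝 (∫ y, h y)) := by
  have hlim : Tendsto (fun r : ℝ≥0 => ∫ y, Real.exp (-y ^ 2 / (2 * r)) * h y) atTop
      (𝓝 (∫ y, h y)) := by
    refine tendsto_integral_filter_of_dominated_convergence (fun y => ‖h y‖)
      (Eventually.of_forall fun r => ?_) (Eventually.of_forall fun r => ae_of_all _ fun y => ?_)
      hh.norm (ae_of_all _ fun y => ?_)
    · exact (Measurable.aestronglyMeasurable (by fun_prop)).mul hh.aestronglyMeasurable
    · rw [norm_mul, Real.norm_of_nonneg (Real.exp_nonneg _)]
      exact mul_le_of_le_one_left (norm_nonneg _) (exp_neg_sq_div_le_one r y)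
    · have h2 : Tendsto (fun r : ℝ≥0 => 2 * (r : ℝ)) atTop atTop :=
        (NNReal.tendsto_coe_atTop.2 tendsto_id).const_mul_atTop two_pos
      have h0 : Tendsto (fun r : ℝ≥0 => -y ^ 2 / (2 * (r : ℝ))) atTop (𝓝 0) :=
        h2.const_div_atTop _
      simpa using ((Real.continuous_exp.tendsto _).comp h0).mul_const (h y)
  refine hlim.congr' ?_
  filter_upwards [eventually_gt_atTop 0] with r hr
  exact (sqrt_mul_integral_gaussianReal hr.ne' h).symm

lemma sqrt_mul_integral_gaussianReal_le {r : ℝ≥0} (hr : r ≠ 0) {h : ℝ → ℝ} (hh : Integrable h)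
    (h0 : ∀ y, 0 ≤ h y) :
    √(2 * Real.pi * r) * ∫ y, h y ∂gaussianReal 0 r ≤ ∫ y, h y := by
  rw [sqrt_mul_integral_gaussianReal hr]
  refine integral_mono_of_nonneg (ae_of_all _ fun y => mul_nonneg (Real.exp_nonneg _) (h0 y)) hh
    (ae_of_all _ fun y => ?_)
  exact mul_le_of_le_one_left (h0 y) (exp_neg_sq_div_le_one r y)

lemma setIntegral_Ioi_pos {φ : ℝ → ℝ} (hφpos : ∀ u, 0 < φ u)
    (hφint : Integrable φ) (s : ℝ) : 0 < ∫ u in Set.Ioi s, φ u := by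
  rw [setIntegral_pos_iff_support_of_nonneg_ae (ae_of_all _ fun u => (hφpos u).le)
    hφint.integrableOn]
  have : Function.support φ = Set.univ := Set.eq_univ_of_forall fun u => (hφpos u).ne'
  simp [this]

lemma integral_comp_max_add_abs {φ : ℝ → ℝ} (hφint : Integrable φ) {s x : ℝ} (hxs : x ≤ s) :
    ∫ y, φ (max s (x + |y|)) = 2 * ((s - x) * φ s + ∫ u in Set.Ioi s, φ u) := by
  rw [integral_comp_abs (f := fun y => φ (max s (x + y)))]
  have h0 : 0 ≤ s - x := sub_nonneg.2 hxs
  have h₁ : Set.EqOn (fun y => φ (max s (x + y))) (fun _ => φ s) (Set.Ioc 0 (s - x)) := by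
    intro y hy
    have : x + y ≤ s := by linarith [hy.2]
    simp [max_eq_left this]
  have h₂ : Set.EqOn (fun y => φ (max s (x + y))) (fun y => φ (x + y)) (Set.Ioi (s - x)) := by
    intro y hy
    have : s ≤ x + y := by linarith [Set.mem_Ioi.1 hy]
    simp [max_eq_right this]
  have hpre : Set.Ioi (s - x) = (fun y => x + y) ⁻¹' Set.Ioi s := by
    ext y; simp [sub_lt_iff_lt_add']
  rw [← Set.Ioc_union_Ioi_eq_Ioi h0, setIntegral_union
    (Set.Ioc_disjoint_Ioi le_rfl) measurableSet_Ioi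
    ((integrableOn_congr_fun h₁ measurableSet_Ioc).2 (by simp))
    ((integrableOn_congr_fun h₂ measurableSet_Ioi).2 (hφint.comp_add_left x).integrableOn),
    setIntegral_congr_fun measurableSet_Ioc h₁, setIntegral_congr_fun measurableSet_Ioi h₂, hpre,
    (measurePreserving_add_left volume x).setIntegral_preimage_emb
      (measurableEmbedding_addLeft x) φ]
  simp [h0]

lemma integrable_comp_max_add_abs {φ : ℝ → ℝ} (hφpos : ∀ u, 0 < φ u)
    (hφint : Integrable φ) {s x : ℝ} (hxs : x ≤ s) :
    Integrable fun y => φ (max s (x + |y|)) := by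
  refine Integrable.of_integral_ne_zero ?_
  rw [integral_comp_max_add_abs hφint hxs]
  have h₁ := setIntegral_Ioi_pos hφpos hφint s
  have h₂ := mul_nonneg (sub_nonneg.2 hxs) (hφpos s).le
  positivity

/-- Asymptotics of `E[1_Γ φ(S_{u+r})]` as `r → ∞`. -/
lemma IsBrownianMotion.tendsto_sqrt_mul_setIntegral {Ω : Type*} [MeasurableSpace Ω]
    {P : Measure Ω} [IsProbabilityMeasure P] {X : ℝ≥0 → Ω → ℝ} {x : ℝ}
    (hX : IsBrownianMotion P X x) {φ : ℝ → ℝ} (hφ : Measurable φ) (hφpos : ∀ u, 0 < φ u)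
    (hφbdd : ∃ C : ℝ, ∀ u, φ u ≤ C) (hφint : Integrable φ) (u : ℝ≥0) {Γ : Set Ω}
    (hΓ : MeasurableSet[natFiltration X u] Γ) :
    Tendsto (fun r : ℝ≥0 => √(2 * Real.pi * r) * ∫ ω in Γ, φ (runSup X (u + r) ω) ∂P) atTop
      (𝓝 (2 * ∫ ω in Γ, ((runSup X u ω - X u ω) * φ (runSup X u ω)
        + ∫ v in Set.Ioi (runSup X u ω), φ v) ∂P)) := by
  obtain ⟨C, hC⟩ := hφbdd
  have hnorm (s : ℝ) : ‖φ s‖ ≤ C := by rw [Real.norm_of_nonneg (hφpos s).le]; exact hC s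
  have hSm : Measurable (denseSup X u) :=
    (measurable_denseSup hX.measurable u).mono ((natFiltration X).le u) le_rfl
  have hle : ∀ᵐ ω ∂P, X u ω ≤ denseSup X u ω := by
    filter_upwards [hX.cont] with ω hc
    rw [denseSup_eq_runSup hc]
    exact (isLUB_runSup hc u).1 ⟨u, Set.mem_Iic.2 le_rfl, rfl⟩
  have hlimit : 2 * ∫ ω in Γ, ((runSup X u ω - X u ω) * φ (runSup X u ω)
        + ∫ v in Set.Ioi (runSup X u ω), φ v) ∂P
      = ∫ ω in Γ, (∫ y, φ (max (denseSup X u ω) (X u ω + |y|))) ∂P := by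
    rw [← integral_const_mul]
    refine integral_congr_ae (ae_restrict_of_ae ?_)
    filter_upwards [hle, hX.denseSup_ae_eq u] with ω hω hd
    rw [integral_comp_max_add_abs hφint hω, hd]
  have hrw (r : ℝ≥0) : √(2 * Real.pi * r) * ∫ ω in Γ, φ (runSup X (u + r) ω) ∂P
      = ∫ ω in Γ, √(2 * Real.pi * r) *
        (∫ y, φ (max (denseSup X u ω) (X u ω + |y|)) ∂gaussianReal 0 r) ∂P := by
    rw [hX.setIntegral_comp_runSup_add u r hΓ hφ hnorm, ← integral_const_mul]
  simp only [hlimit, hrw]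
  refine tendsto_integral_filter_of_dominated_convergence
    (fun ω => 2 * ((runSup X u ω - X u ω) * C + ∫ v, φ v)) (Eventually.of_forall fun r => ?_) ?_ ?_
    (ae_restrict_of_ae ?_)
  · have hF : Measurable fun p : Ω × ℝ => φ (max (denseSup X u p.1) (X u p.1 + |p.2|)) :=
      hφ.comp ((hSm.comp measurable_fst).max
        (((hX.measurable u).comp measurable_fst).add measurable_snd.abs))
    exact ((hF.stronglyMeasurable.integral_prod_right' (ν := gaussianReal 0 r)).const_mul
      _).aestronglyMeasurable
  · filter_upwards [eventually_gt_atTop 0] with r hr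
    refine ae_restrict_of_ae ?_
    filter_upwards [hle, hX.denseSup_ae_eq u] with ω hω hd
    rw [Real.norm_of_nonneg (mul_nonneg (Real.sqrt_nonneg _)
      (integral_nonneg fun y => (hφpos _).le))]
    refine (sqrt_mul_integral_gaussianReal_le hr.ne'
      (integrable_comp_max_add_abs hφpos hφint hω) fun y => (hφpos _).le).trans ?_
    rw [integral_comp_max_add_abs hφint hω, ← hd]
    exact mul_le_mul_of_nonneg_left
      (add_le_add (mul_le_mul_of_nonneg_left (hC _) (sub_nonneg.2 hω))
        (setIntegral_le_integral hφint (ae_of_all _ fun v => (hφpos v).le))) zero_le_two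
  · exact (((((hX.integrable_runSup u).sub (hX.integrable_eval u)).mul_const C).add
      (integrable_const _)).const_mul 2).integrableOn
  · filter_upwards [hle] with ω hω
    exact tendsto_sqrt_mul_integral_gaussianReal (integrable_comp_max_add_abs hφpos hφint hω)

/-- Penalization of Brownian motion by a function of its one-sided maximum:
`E_x[1_Γ φ(S_t)] / E_x[φ(S_t)] → E_x[1_Γ M_u^φ] / (1 - Φ(x))` as `t → ∞`,
for every `u ≥ 0` and `Γ ∈ F_u`, where `M_u^φ = (S_u - X_u)φ(S_u) + 1 - Φ(S_u)`. -/
theorem penalization_max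
    {Ω : Type*} [m : MeasurableSpace Ω] (P : Measure Ω) [IsProbabilityMeasure P]
    (x : ℝ) (X : ℝ≥0 → Ω → ℝ) (hX : IsBrownianMotion P X x)
    (φ : ℝ → ℝ) (hφmeas : Measurable φ) (hφpos : ∀ u, 0 < φ u)
    (hφbdd : ∃ Cb : ℝ, ∀ u, φ u ≤ Cb)
    (hφint : Integrable φ) (hφone : (∫ u, φ u) = 1)
    (Φ : ℝ → ℝ) (hΦ : ∀ s, Φ s = ∫ u in Set.Iic s, φ u) :
    ∀ (u : ℝ≥0) (Γ : Set Ω), MeasurableSet[natFiltration X u] Γ →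
      Tendsto
        (fun t : ℝ≥0 => (∫ ω in Γ, φ (runSup X t ω) ∂P) / ∫ ω, φ (runSup X t ω) ∂P)
        atTop
        (nhds ((∫ ω in Γ,
            ((runSup X u ω - X u ω) * φ (runSup X u ω) + 1 - Φ (runSup X u ω)) ∂P)
          / (1 - Φ x))) := by


  intro u Γ hΓ
  have htail (s : ℝ) : ∫ v in Set.Ioi s, φ v = 1 - Φ s := by
    have h := integral_add_compl (measurableSet_Iic (a := s)) hφint
    rw [Set.compl_Iic, hφone, ← hΦ] at h
    linarith
  have hpos : 0 < 1 - Φ x := htail x ▸ setIntegral_Ioi_pos hφpos hφint x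
  have hnum := hX.tendsto_sqrt_mul_setIntegral hφmeas hφpos hφbdd hφint u hΓ
  have hden := hX.tendsto_sqrt_mul_setIntegral hφmeas hφpos hφbdd hφint 0 MeasurableSet.univ
  simp only [htail, ← add_sub_assoc] at hnum hden
  have hstart : ∫ ω in Set.univ, ((runSup X 0 ω - X 0 ω) * φ (runSup X 0 ω) + 1
      - Φ (runSup X 0 ω)) ∂P = 1 - Φ x := by
    rw [Measure.restrict_univ, integral_congr_ae (g := fun _ => 1 - Φ x)]
    · simp
    · filter_upwards [hX.init] with ω h0
      rw [runSup_zero, h0]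
      ring
  rw [hstart] at hden
  simp only [zero_add, Measure.restrict_univ] at hden
  have hsub : Tendsto (fun t : ℝ≥0 => t - u) atTop atTop :=
    tendsto_atTop.2 fun b => (eventually_ge_atTop (b + u)).mono fun t ht => le_tsub_of_add_le_right ht
  have hratio : Tendsto (fun t : ℝ≥0 => √(2 * Real.pi * t) / √(2 * Real.pi * (t - u : ℝ≥0)))
      atTop (𝓝 1) := by
    have h₁ : Tendsto (fun r : ℝ≥0 => √(1 + u / r)) atTop (𝓝 1) := by
      have h := ((NNReal.tendsto_coe_atTop.2 tendsto_id).const_div_atTop (u : ℝ)).const_add 1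
      simpa [Function.comp_def] using (Real.continuous_sqrt.tendsto _).comp h
    refine (h₁.comp hsub).congr' ?_
    filter_upwards [eventually_gt_atTop u] with t ht
    have hr : (0 : ℝ) < (t - u : ℝ≥0) := NNReal.coe_pos.2 (tsub_pos_of_lt ht)
    have ht' : (t : ℝ) = (t - u : ℝ≥0) + u := by exact_mod_cast (tsub_add_cancel_of_le ht.le).symm
    rw [Function.comp_apply, ← Real.sqrt_div (by positivity)]
    congr 1
    rw [ht', mul_div_mul_left _ _ (by positivity), add_div, div_self hr.ne']
  have hlim := ((hnum.comp hsub).div hden (by positivity)).mul hratio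
  rw [mul_one, mul_div_mul_left _ _ two_ne_zero] at hlim
  refine hlim.congr' ?_
  filter_upwards [eventually_gt_atTop u] with t ht
  have hr : (0 : ℝ) < (t - u : ℝ≥0) := NNReal.coe_pos.2 (tsub_pos_of_lt ht)
  have ht0 : (0 : ℝ) < t := NNReal.coe_pos.2 (bot_le.trans_lt ht)
  have h₁ : √(2 * Real.pi * (t - u : ℝ≥0)) ≠ 0 := by positivity
  have h₂ : √(2 * Real.pi * t) ≠ 0 := by positivity
  simp only [Pi.div_apply, Function.comp_apply, add_tsub_cancel_of_le ht.le]
  field_simp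

end
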